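/- arXiv:2304.07601 — 2 statements merged into one kernel-verified Lean document; each statement's English description precedes it below -/
import Mathlib

section
/- Let A:ℝ→ℝ^{n×n} be continuous with A(x) symmetric for all x, let λ0 ∈ ℝ, and let u_*:ℝ→ℝⁿ be a nonzero, bounded, twice continuously differentiable solution of −u_*'' + A(x)u_* = λ0 u_*. Let v:ℝ→ℝⁿ be continuous and bounded. If ∫_ℝ ⟨v(x), B(x)u_*(x)⟩ dx = 0 for every B ∈ X_β, then v(x) = 0 for all x ∈ ℝ. -/
open Matrix MeasureTheory

attribute [local instance] Matrix.normedAddCommGroup Matrix.normedSpace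

/-- A solution of a linear ODE with continuous coefficients that vanishes at one point is zero. -/
theorem eq_zero_of_hasDerivAt_linear {E : Type*} [NormedAddCommGroup E] [NormedSpace ℝ E]
    {L : ℝ → E →L[ℝ] E} (hL : Continuous L) {y : ℝ → E}
    (hy : ∀ t, HasDerivAt y (L t (y t)) t) {t₀ : ℝ} (h0 : y t₀ = 0) (t : ℝ) : y t = 0 := by
  obtain ⟨a, b, ht, ht₀⟩ : ∃ a b, t ∈ Set.Ioo a b ∧ t₀ ∈ Set.Ioo a b := by
    use (min (-|t|) (-|t₀|) - 1), (max |t| |t₀| + 1)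
    grind
  obtain ⟨C, hC⟩ := (isCompact_Icc (a := a) (b := b)).exists_bound_of_continuousOn hL.continuousOn
  have key := ODE_solution_unique_of_mem_Ioo (K := C.toNNReal) (v := fun t x => L t x)
    (s := fun _ => Set.univ) (f := y) (g := fun _ => (0 : E)) (a := a) (b := b) (t₀ := t₀)
    (fun s hs => by
      refine ((L s).lipschitz.weaken ?_).lipschitzOnWith
      rw [← NNReal.coe_le_coe]
      exact (hC s (Set.Ioo_subset_Icc_self hs)).trans (Real.le_coe_toNNReal C))
    ht₀ (fun s _ => ⟨hy s, trivial⟩)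
    (fun s _ => ⟨by simpa using hasDerivAt_const s (0 : E), trivial⟩) h0
  exact key ht

/-- A solution of a second-order linear system `u'' = M u` with continuous coefficients and zero
Cauchy data at one point is zero. -/
theorem eq_zero_of_deriv_deriv_eq_mulVec {n : ℕ} {M : ℝ → Matrix (Fin n) (Fin n) ℝ}
    (hM : Continuous M) {u : ℝ → Fin n → ℝ} (hu : ContDiff ℝ 2 u)
    (hueq : ∀ x, deriv (deriv u) x = M x *ᵥ u x) {x₀ : ℝ} (h0 : u x₀ = 0)
    (h1 : deriv u x₀ = 0) (x : ℝ) : u x = 0 := by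
  let Φ : Matrix (Fin n) (Fin n) ℝ →ₗ[ℝ] ((Fin n → ℝ) →L[ℝ] (Fin n → ℝ)) :=
    LinearMap.toContinuousLinearMap.toLinearMap ∘ₗ (Matrix.toLin' (R := ℝ)).toLinearMap
  have hΦ : Continuous Φ := Φ.continuous_of_finiteDimensional
  let L : ℝ → ((Fin n → ℝ) × (Fin n → ℝ)) →L[ℝ] ((Fin n → ℝ) × (Fin n → ℝ)) := fun t =>
    (ContinuousLinearMap.inl ℝ _ _).comp (ContinuousLinearMap.snd ℝ _ _) +
      (ContinuousLinearMap.inr ℝ _ _).comp ((Φ (M t)).comp (ContinuousLinearMap.fst ℝ _ _))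
  have hL : Continuous L :=
    continuous_const.add (continuous_const.clm_comp ((hΦ.comp hM).clm_comp continuous_const))
  have hu1 : ContDiff ℝ 1 (deriv u) := (contDiff_succ_iff_deriv (n := 1).1 hu).2.2
  have key := eq_zero_of_hasDerivAt_linear hL (y := fun t => (u t, deriv u t)) (fun t => by
    have e : L t (u t, deriv u t) = (deriv u t, deriv (deriv u) t) := by
      simp [L, Φ, hueq]
    rw [e]
    exact ((hu.differentiable (by norm_num)) t).hasDerivAt.prodMk
      ((hu1.differentiable (by norm_num)) t).hasDerivAt) (t₀ := x₀) (by simp [h0, h1]) x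
  exact congrArg Prod.fst key

theorem abs_dotProduct_le {n : ℕ} {a b : Fin n → ℝ} {Ca Cb : ℝ} (ha : ‖a‖ ≤ Ca) (hb : ‖b‖ ≤ Cb) :
    |a ⬝ᵥ b| ≤ n * (Ca * Cb) := by
  calc |a ⬝ᵥ b| ≤ ∑ i, |a i * b i| := Finset.abs_sum_le_sum_abs _ _
    _ ≤ ∑ _i : Fin n, Ca * Cb := by
        refine Finset.sum_le_sum fun i _ => ?_
        rw [abs_mul]
        exact mul_le_mul ((norm_le_pi_norm a i).trans ha) ((norm_le_pi_norm b i).trans hb)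
          (abs_nonneg _) ((norm_nonneg a).trans ha)
    _ = n * (Ca * Cb) := by simp

/-- Let `u_*` be a nonzero, bounded, `C²` solution of
`−u_*'' + A(x)u_* = λ0 u_*` with `A` continuous and symmetric-valued, and let `v` be
continuous and bounded.  If `∫_ℝ ⟨v(x), B(x)u_*(x)⟩ dx = 0` for every `B ∈ X_β`
(continuous, symmetric-valued, with `sup_x |B(x)|(1+|x|)^β < ∞`), then `v ≡ 0`. -/
theorem vanishing_against_all_perturbations (n : ℕ) (β : ℝ) (hβ : 1 < β)
    (A : ℝ → Matrix (Fin n) (Fin n) ℝ) (hAc : Continuous A) (hAs : ∀ x, (A x)ᵀ = A x)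
    (lam0 : ℝ) (ustar : ℝ → Fin n → ℝ)
    (hu2 : ContDiff ℝ 2 ustar) (hune : ustar ≠ 0)
    (hubdd : ∃ Cu : ℝ, ∀ x : ℝ, ‖ustar x‖ ≤ Cu)
    (hueq : ∀ x : ℝ, -(deriv (deriv ustar) x) + A x *ᵥ ustar x = lam0 • ustar x)
    (v : ℝ → Fin n → ℝ) (hvc : Continuous v) (hvbdd : ∃ Cv : ℝ, ∀ x : ℝ, ‖v x‖ ≤ Cv)
    (hint : ∀ B : ℝ → Matrix (Fin n) (Fin n) ℝ, Continuous B → (∀ x, (B x)ᵀ = B x) →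
      (∃ CB : ℝ, ∀ x : ℝ, ‖B x‖ * (1 + |x|) ^ β ≤ CB) →
      (∫ x : ℝ, v x ⬝ᵥ (B x *ᵥ ustar x)) = 0) :
    ∀ x : ℝ, v x = 0 := by
  obtain ⟨Cu, hCu⟩ := hubdd
  obtain ⟨Cv, hCv⟩ := hvbdd
  have huc : Continuous ustar := hu2.continuous
  let w : ℝ → ℝ := fun x => (1 + |x|) ^ (-β)
  let S : ℝ → Matrix (Fin n) (Fin n) ℝ := fun x =>
    vecMulVec (v x) (ustar x) + vecMulVec (ustar x) (v x)
  let q : ℝ → ℝ := fun x =>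
    (v x ⬝ᵥ v x) * (ustar x ⬝ᵥ ustar x) + (v x ⬝ᵥ ustar x) * (v x ⬝ᵥ ustar x)
  have hpos : ∀ x : ℝ, 0 < 1 + |x| := fun x => by positivity
  have hwpos : ∀ x, 0 < w x := fun x => Real.rpow_pos_of_pos (hpos x) _
  have hwc : Continuous w :=
    (continuous_const.add continuous_abs).rpow_const fun x => Or.inl (hpos x).ne'
  have hSc : Continuous S := (hvc.matrix_vecMulVec huc).add (huc.matrix_vecMulVec hvc)
  have hqc : Continuous q :=
    ((hvc.dotProduct hvc).mul (huc.dotProduct huc)).add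
      ((hvc.dotProduct huc).mul (hvc.dotProduct huc))
  have hsq : ∀ a : Fin n → ℝ, 0 ≤ a ⬝ᵥ a := fun a => Finset.sum_nonneg fun i _ => mul_self_nonneg _
  have hq0 : ∀ x, 0 ≤ q x := fun x =>
    add_nonneg (mul_nonneg (hsq _) (hsq _)) (mul_self_nonneg _)
  have hqform : ∀ x, v x ⬝ᵥ ((w x • S x) *ᵥ ustar x) = w x * q x := by
    intro x
    simp only [S, q, smul_mulVec, add_mulVec, vecMulVec_mulVec, dotProduct_smul, dotProduct_add,
      smul_eq_mul, op_smul_eq_smul]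
    ring
  have hB := hint (fun x => w x • S x) (hwc.smul hSc)
    (fun x => by simp [S, transpose_vecMulVec, add_comm])
    ⟨Cv * Cu + Cu * Cv, fun x => by
      have hCv0 : 0 ≤ Cv := (norm_nonneg _).trans (hCv 0)
      have hCu0 : 0 ≤ Cu := (norm_nonneg _).trans (hCu 0)
      have hS : ‖S x‖ ≤ Cv * Cu + Cu * Cv := by
        rw [Matrix.norm_le_iff (by positivity)]
        intro i j
        have hvi := fun i => (norm_le_pi_norm (v x) i).trans (hCv x)
        have hui := fun i => (norm_le_pi_norm (ustar x) i).trans (hCu x)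
        simp only [S, Matrix.add_apply, vecMulVec_apply]
        refine (norm_add_le _ _).trans (add_le_add ?_ ?_)
        · rw [norm_mul]
          exact mul_le_mul (hvi i) (hui j) (norm_nonneg _) hCv0
        · rw [norm_mul]
          exact mul_le_mul (hui i) (hvi j) (norm_nonneg _) hCu0
      have hw1 : w x * (1 + |x|) ^ β = 1 := by
        rw [← Real.rpow_add (hpos x)]
        simp
      rw [norm_smul, Real.norm_of_nonneg (hwpos x).le, mul_right_comm, hw1, one_mul]
      exact hS⟩
  simp only [hqform] at hB
  have hwi : Integrable w := by
    simpa [w, Real.norm_eq_abs] using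
      integrable_one_add_norm (E := ℝ) (μ := volume) (r := β) (by simpa using hβ)
  obtain ⟨C, hC⟩ : ∃ C, ∀ x, ‖q x‖ ≤ C := by
    refine ⟨n * (Cv * Cv) * (n * (Cu * Cu)) + n * (Cv * Cu) * (n * (Cv * Cu)), fun x => ?_⟩
    have h1 := abs_dotProduct_le (hCv x) (hCv x)
    have h2 := abs_dotProduct_le (hCu x) (hCu x)
    have h3 := abs_dotProduct_le (hCv x) (hCu x)
    refine (norm_add_le _ _).trans (add_le_add ?_ ?_) <;> rw [norm_mul]
    · exact mul_le_mul h1 h2 (norm_nonneg _) ((abs_nonneg _).trans h1)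
    · exact mul_le_mul h3 h3 (norm_nonneg _) ((abs_nonneg _).trans h3)
  have hfi : Integrable fun x => w x * q x :=
    hwi.mul_bdd hqc.aestronglyMeasurable (Filter.Eventually.of_forall hC)
  have hq : ∀ x, q x = 0 := by
    have hae := (integral_eq_zero_iff_of_nonneg
      (fun x => mul_nonneg (hwpos x).le (hq0 x)) hfi).1 hB
    have heq := ((hwc.mul hqc).ae_eq_iff_eq volume continuous_zero).1 hae
    exact fun x => (mul_eq_zero.1 (congrFun heq x)).resolve_left (hwpos x).ne'
  have hor : ∀ x, v x ≠ 0 → ustar x = 0 := by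
    intro x hvx
    have h := hq x
    have h1 : (v x ⬝ᵥ v x) * (ustar x ⬝ᵥ ustar x) = 0 :=
      ((add_eq_zero_iff_of_nonneg (mul_nonneg (hsq _) (hsq _)) (mul_self_nonneg _)).1 h).1
    exact dotProduct_self_eq_zero.1
      ((mul_eq_zero.1 h1).resolve_left fun h => hvx (dotProduct_self_eq_zero.1 h))
  intro x₀
  by_contra hvx
  have hev : ustar =ᶠ[nhds x₀] fun _ => 0 :=
    (hvc.continuousAt.eventually_ne hvx).mono hor
  refine hune (funext fun x => eq_zero_of_deriv_deriv_eq_mulVec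
    (M := fun x => A x - lam0 • (1 : Matrix (Fin n) (Fin n) ℝ)) (hAc.sub continuous_const)
    hu2 (fun y => ?_) hev.eq_of_nhds (by simp [hev.deriv_eq]) x)
  rw [sub_mulVec, smul_mulVec, one_mulVec, ← hueq y]
  abel
end

section
/- Let n ≥ 2, let A:ℝ→ℝ^{n×n} be continuous and diagonal, let λ0 ∈ ℝ, and let u_* = (u_{*1}, 0, …, 0):ℝ→ℝⁿ where u_{*1} is a nonzero, bounded, twice continuously differentiable solution of −u_{*1}'' + a_{11}(x)u_{*1} = λ0 u_{*1} (a_{11} the first diagonal entry of A). Let T_β ⊂ X_β be the subspace of matrices B with zero diagonal entries and b_{ij} = 0 unless i = 1 or j = 1. Let v:ℝ→ℝⁿ be continuous and bounded. If ∫_ℝ ⟨v(x), B(x)u_*(x)⟩ dx = 0 for every B ∈ T_β, then v_j(x) = 0 for all x ∈ ℝ and every j ≠ 1. -/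
open Matrix MeasureTheory

attribute [local instance] Matrix.normedAddCommGroup Matrix.normedSpace

/-- A `C²` solution of `f'' = q f` with continuous `q` and vanishing Cauchy data at a point
vanishes identically. -/
theorem eq_zero_of_deriv_deriv_eq_mul {q f : ℝ → ℝ} (hq : Continuous q) (hf : ContDiff ℝ 2 f)
    (hfq : ∀ x, deriv (deriv f) x = q x * f x) {x₀ : ℝ} (h₀ : f x₀ = 0)
    (h₁ : deriv f x₀ = 0) : f = 0 := by
  have hd : Differentiable ℝ f := hf.differentiable (by norm_num)
  have hdd : Differentiable ℝ (deriv f) :=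
    ((contDiff_succ_iff_deriv (n := 1)).1 hf).2.2.differentiable (by norm_num)
  funext x
  obtain ⟨a, b, hx, hx₀⟩ : ∃ a b, x ∈ Set.Ioo a b ∧ x₀ ∈ Set.Ioo a b := by
    refine ⟨min x x₀ - 1, max x x₀ + 1, ?_⟩
    grind
  obtain ⟨M, hM⟩ := (isCompact_Icc (a := a) (b := b)).exists_bound_of_continuousOn hq.continuousOn
  have hlip : ∀ t ∈ Set.Ioo a b,
      LipschitzOnWith (max 1 M.toNNReal) (fun p : ℝ × ℝ ↦ (p.2, q t * p.1)) Set.univ := by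
    intro t ht
    refine LipschitzWith.lipschitzOnWith ?_
    have hqt : LipschitzWith M.toNNReal (fun p : ℝ × ℝ ↦ q t * p.1) := by
      refine LipschitzWith.of_dist_le_mul fun p r ↦ ?_
      have hMt := hM t (Set.Ioo_subset_Icc_self ht)
      rw [Real.coe_toNNReal _ ((norm_nonneg _).trans hMt), Real.dist_eq, ← mul_sub, abs_mul]
      have hpr : |p.1 - r.1| ≤ dist p r := by
        rw [← Real.dist_eq, Prod.dist_eq]; exact le_max_left _ _
      exact mul_le_mul hMt hpr (abs_nonneg _) ((norm_nonneg _).trans hMt)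
    exact LipschitzWith.prodMk LipschitzWith.prod_snd hqt
  have heq := ODE_solution_unique_of_mem_Ioo (v := fun t (p : ℝ × ℝ) ↦ (p.2, q t * p.1))
    (f := fun t ↦ (f t, deriv f t)) (g := fun _ ↦ 0) hlip hx₀
    (fun t _ ↦ ⟨(hd t).hasDerivAt.prodMk (hfq t ▸ (hdd t).hasDerivAt), Set.mem_univ _⟩)
    (fun t _ ↦ ⟨by simpa [Prod.mk_zero_zero] using hasDerivAt_const t (0 : ℝ × ℝ), Set.mem_univ _⟩)
    (by simp [h₀, h₁])
  exact congrArg Prod.fst (heq hx)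

/-- The zero set of a nontrivial `C²` solution of `f'' = q f` with continuous `q` has empty
interior. -/
theorem dense_ne_zero_of_deriv_deriv_eq_mul {q f : ℝ → ℝ} (hq : Continuous q)
    (hf : ContDiff ℝ 2 f) (hfq : ∀ x, deriv (deriv f) x = q x * f x) (hne : f ≠ 0) :
    Dense {x | f x ≠ 0} := by
  intro x
  by_contra hx
  have hev : f =ᶠ[nhds x] fun _ ↦ 0 := by
    rw [mem_closure_iff_frequently, Filter.not_frequently] at hx
    exact hx.mono fun y hy ↦ not_not.1 hy
  refine hne (eq_zero_of_deriv_deriv_eq_mul hq hf hfq hev.eq_of_nhds ?_)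
  simpa using hev.deriv_eq

/-- If `w` is continuous and bounded and `w²` has zero integral against a positive continuous
integrable weight, then `w` vanishes. -/
theorem eq_zero_of_integral_weight_mul_sq_eq_zero {φ w : ℝ → ℝ} (hφ : Continuous φ)
    (hφpos : ∀ x, 0 < φ x) (hφi : Integrable φ) (hw : Continuous w) {C : ℝ}
    (hC : ∀ x, |w x| ≤ C) (h : ∫ x, φ x * w x ^ 2 = 0) : w = 0 := by
  have hint : Integrable fun x ↦ φ x * w x ^ 2 := by
    refine hφi.mul_bdd (c := C ^ 2) (hw.pow 2).aestronglyMeasurable (.of_forall fun x ↦ ?_)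
    rw [Real.norm_eq_abs, abs_pow]
    exact pow_le_pow_left₀ (abs_nonneg _) (hC x) 2
  have hae := (integral_eq_zero_iff_of_nonneg
    (fun x ↦ mul_nonneg (hφpos x).le (sq_nonneg _)) hint).1 h
  have hzero := (Continuous.ae_eq_iff_eq volume (hφ.mul (hw.pow 2)) continuous_zero).1 hae
  funext x
  simpa [(hφpos x).ne'] using congrFun hzero x

/-- Let `n ≥ 2`, `A` continuous and diagonal, and
`u_* = (u_{*1}, 0, …, 0)` with `u_{*1}` a nonzero bounded `C²` solution of
`−u_{*1}'' + a_{11}(x)u_{*1} = λ0 u_{*1}`.  Let `T_β ⊂ X_β` be the subspace of matrices with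
zero diagonal and `b_{ij} = 0` unless `i = 1` or `j = 1`.  If `v` is continuous and bounded
and `∫_ℝ ⟨v(x), B(x)u_*(x)⟩ dx = 0` for every `B ∈ T_β`, then `v_j ≡ 0` for every `j ≠ 1`. -/
theorem vanishing_against_minimal_subspace (n : ℕ) (hn : 2 ≤ n) (β : ℝ) (hβ : 1 < β)
    (A : ℝ → Matrix (Fin n) (Fin n) ℝ) (hAc : Continuous A)
    (hAdiag : ∀ (x : ℝ) (i j : Fin n), i ≠ j → A x i j = 0)
    (lam0 : ℝ) (u1 : ℝ → ℝ)
    (hu2 : ContDiff ℝ 2 u1) (hune : u1 ≠ 0)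
    (hubdd : ∃ Cu : ℝ, ∀ x : ℝ, |u1 x| ≤ Cu)
    (hueq : ∀ x : ℝ,
      -(deriv (deriv u1) x) + A x ⟨0, by omega⟩ ⟨0, by omega⟩ * u1 x = lam0 * u1 x)
    (ustar : ℝ → Fin n → ℝ)
    (hustar : ∀ (x : ℝ) (i : Fin n), ustar x i = if i = ⟨0, by omega⟩ then u1 x else 0)
    (v : ℝ → Fin n → ℝ) (hvc : Continuous v) (hvbdd : ∃ Cv : ℝ, ∀ x : ℝ, ‖v x‖ ≤ Cv)
    (hint : ∀ B : ℝ → Matrix (Fin n) (Fin n) ℝ, Continuous B → (∀ x, (B x)ᵀ = B x) →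
      (∀ (x : ℝ) (i : Fin n), B x i i = 0) →
      (∀ (x : ℝ) (i j : Fin n), i ≠ ⟨0, by omega⟩ → j ≠ ⟨0, by omega⟩ → B x i j = 0) →
      (∃ CB : ℝ, ∀ x : ℝ, ‖B x‖ * (1 + |x|) ^ β ≤ CB) →
      (∫ x : ℝ, v x ⬝ᵥ (B x *ᵥ ustar x)) = 0) :
    ∀ j : Fin n, j ≠ ⟨0, by omega⟩ → ∀ x : ℝ, v x j = 0 := by
  intro j hj
  set i₀ : Fin n := ⟨0, by omega⟩
  obtain ⟨Cu, hCu⟩ := hubdd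
  obtain ⟨Cv, hCv⟩ := hvbdd
  have hvj : Continuous fun x ↦ v x j := (continuous_apply j).comp hvc
  have hpos : ∀ x : ℝ, 0 < 1 + |x| := fun x ↦ by positivity
  have hφ : Continuous fun x : ℝ ↦ (1 + |x|) ^ (-β) :=
    (continuous_const.add continuous_abs).rpow_const fun x ↦ Or.inl (hpos x).ne'
  have hw : ∀ x, |v x j * u1 x| ≤ Cv * Cu := fun x ↦ by
    rw [abs_mul]
    have hvx : |v x j| ≤ Cv := (norm_le_pi_norm (v x) j).trans (hCv x)
    exact mul_le_mul hvx (hCu x) (abs_nonneg _) ((abs_nonneg _).trans hvx)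
  have hustar' : ∀ x, ustar x = Pi.single i₀ (u1 x) := fun x ↦ by
    funext i
    rw [hustar, Pi.single_apply]
  set E : Matrix (Fin n) (Fin n) ℝ := Matrix.single j i₀ 1 + Matrix.single i₀ j 1 with hE
  have hEsymm : Eᵀ = E := by
    rw [hE, Matrix.transpose_add, Matrix.transpose_single, Matrix.transpose_single]
    exact add_comm _ _
  have hEdiag : ∀ i, E i i = 0 := fun i ↦ by
    rw [hE, Matrix.add_apply, Matrix.single_apply_of_ne, Matrix.single_apply_of_ne, add_zero]
    · rintro ⟨rfl, h⟩
      exact hj h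
    · rintro ⟨rfl, h⟩
      exact hj h.symm
  have hEzero : ∀ i k, i ≠ i₀ → k ≠ i₀ → E i k = 0 := fun i k hi hk ↦ by
    rw [hE, Matrix.add_apply, Matrix.single_apply_of_col_ne _ _ hk.symm,
      Matrix.single_apply_of_row_ne hi.symm, add_zero]
  have hcol : E.col i₀ = Pi.single j 1 := by
    funext i
    simp [hE, Matrix.single_apply, Pi.single_apply, hj, eq_comm]
  have hprod : (fun x ↦ v x j * u1 x) = 0 := by
    refine eq_zero_of_integral_weight_mul_sq_eq_zero hφ
      (fun x ↦ Real.rpow_pos_of_pos (hpos x) _)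
      (integrable_one_add_norm (E := ℝ) (by simpa using hβ)) (hvj.mul hu2.continuous) hw ?_
    have hB := hint (fun x ↦ ((1 + |x|) ^ (-β) * (v x j * u1 x)) • E)
      ((hφ.mul (hvj.mul hu2.continuous)).smul continuous_const)
      (fun x ↦ by rw [Matrix.transpose_smul, hEsymm])
      (fun x i ↦ by rw [Matrix.smul_apply, hEdiag, smul_zero])
      (fun x i k hi hk ↦ by rw [Matrix.smul_apply, hEzero i k hi hk, smul_zero])
      ⟨Cv * Cu * ‖E‖, fun x ↦ by
        have hcancel : (1 + |x|) ^ (-β) * (1 + |x|) ^ β = 1 := by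
          rw [← Real.rpow_add (hpos x), neg_add_cancel, Real.rpow_zero]
        rw [norm_smul, Real.norm_eq_abs, abs_mul,
          abs_of_pos (Real.rpow_pos_of_pos (hpos x) _)]
        calc _ = (1 + |x|) ^ (-β) * (1 + |x|) ^ β * (|v x j * u1 x| * ‖E‖) := by ring
          _ ≤ Cv * Cu * ‖E‖ := by
            rw [hcancel, one_mul]
            exact mul_le_mul_of_nonneg_right (hw x) (norm_nonneg _)⟩
    rw [← hB]
    refine integral_congr_ae (.of_forall fun x ↦ ?_)
    simp only [hustar', Matrix.smul_mulVec (R := ℝ), Matrix.mulVec_single, hcol, dotProduct_smul,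
      dotProduct_single, smul_eq_mul, op_smul_eq_smul]
    ring
  have hdense : Dense {x | u1 x ≠ 0} :=
    dense_ne_zero_of_deriv_deriv_eq_mul (q := fun x ↦ A x i₀ i₀ - lam0)
      ((hAc.matrix_elem i₀ i₀).sub continuous_const) hu2
      (fun x ↦ by linarith [hueq x]) hune
  have hzero : (fun x ↦ v x j) = fun _ ↦ 0 :=
    hvj.ext_on hdense continuous_const fun x hx ↦
      (mul_eq_zero.1 (congrFun hprod x)).resolve_right hx
  exact congrFun hzero
end
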